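/- arXiv:1912.12509 — 2 statements merged into one kernel-verified Lean document; each statement's English description precedes it below -/
import Mathlib

section
/- The Pekar energy is finite and strictly negative: the set { 𝓔^Pek(ψ) : ψ a Schwartz function on ℝ³ with ∫_{ℝ³}|ψ|² = 1 } is bounded below, and its infimum e^Pek satisfies e^Pek < 0. -/
open MeasureTheory Real

noncomputable section

/-- `ℝ³` as a Euclidean space. -/
abbrev E3 := EuclideanSpace ℝ (Fin 3)

/-- The Pekar functional
`𝓔^Pek(ψ) = ∫ |∇ψ|² − ∫∫ |ψ(x)|²|ψ(y)|²/|x−y| dx dy`. -/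
def pekarF (ψ : SchwartzMap E3 ℂ) : ℝ :=
  (∫ x : E3, ‖fderiv ℝ ψ x‖ ^ 2) -
    ∫ x : E3, ∫ y : E3, ‖ψ x‖ ^ 2 * ‖ψ y‖ ^ 2 / ‖x - y‖

/-- The set of values of `𝓔^Pek` on normalized Schwartz functions. -/
def pekarSet : Set ℝ :=
  {e | ∃ ψ : SchwartzMap E3 ℂ, (∫ x : E3, ‖ψ x‖ ^ 2) = 1 ∧ pekarF ψ = e}

open Filter Topology
open scoped ContDiff

lemma hasFDerivAt_coord_mul_inv_sqrt {ε : ℝ} (hε : 0 < ε) (i : Fin 3) (y : E3) :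
    HasFDerivAt (fun y : E3 ↦ y i * (√(ε + ‖y‖ ^ 2))⁻¹)
      (y i • (-(√(ε + ‖y‖ ^ 2) ^ 2)⁻¹ • (1 / (2 * √(ε + ‖y‖ ^ 2))) •
          (2 • innerSL ℝ y)) +
        (√(ε + ‖y‖ ^ 2))⁻¹ • (EuclideanSpace.proj i : E3 →L[ℝ] ℝ)) y := by
  have hpos : 0 < ε + ‖y‖ ^ 2 := by positivity
  have h1 : HasFDerivAt (fun y : E3 ↦ ε + ‖y‖ ^ 2) (2 • innerSL ℝ y) y :=
    ((hasStrictFDerivAt_norm_sq y).hasFDerivAt).const_add ε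
  have h2 := h1.sqrt hpos.ne'
  have h3 := (hasDerivAt_inv (sqrt_pos.2 hpos).ne').comp_hasFDerivAt y h2
  have h4 : HasFDerivAt (fun y : E3 ↦ y i) (EuclideanSpace.proj i : E3 →L[ℝ] ℝ) y :=
    (EuclideanSpace.proj i : E3 →L[ℝ] ℝ).hasFDerivAt
  exact h4.mul h3

lemma fderiv_coord_mul_inv_sqrt {ε : ℝ} (hε : 0 < ε) (i : Fin 3) (y : E3) :
    fderiv ℝ (fun y : E3 ↦ y i * (√(ε + ‖y‖ ^ 2))⁻¹) y (EuclideanSpace.single i 1) =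
      (√(ε + ‖y‖ ^ 2))⁻¹ - y i ^ 2 * (√(ε + ‖y‖ ^ 2))⁻¹ ^ 3 := by
  have hs : √(ε + ‖y‖ ^ 2) ≠ 0 := (sqrt_pos.2 (by positivity)).ne'
  rw [(hasFDerivAt_coord_mul_inv_sqrt hε i y).fderiv]
  have hi : inner ℝ y (EuclideanSpace.single i (1 : ℝ)) = y i := by
    simp [EuclideanSpace.inner_single_right]
  simp [hi]
  field_simp
  ring

lemma abs_coord_mul_inv_sqrt_le {ε : ℝ} (hε : 0 < ε) (i : Fin 3) (y : E3) :
    |y i * (√(ε + ‖y‖ ^ 2))⁻¹| ≤ 1 := by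
  have hs : 0 < √(ε + ‖y‖ ^ 2) := sqrt_pos.2 (by positivity)
  rw [abs_mul, abs_inv, abs_of_pos hs, ← div_eq_mul_inv, div_le_one hs]
  apply (PiLp.norm_apply_le y i).trans
  apply Real.le_sqrt_of_sq_le
  linarith

lemma abs_fderiv_coord_mul_inv_sqrt_le {ε : ℝ} (hε : 0 < ε) (i : Fin 3) (y : E3) :
    |fderiv ℝ (fun y : E3 ↦ y i * (√(ε + ‖y‖ ^ 2))⁻¹) y (EuclideanSpace.single i 1)| ≤
      (√ε)⁻¹ := by
  have hs : 0 < (√(ε + ‖y‖ ^ 2))⁻¹ := inv_pos.2 (sqrt_pos.2 (by positivity))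
  have h1 : (√(ε + ‖y‖ ^ 2))⁻¹ ≤ (√ε)⁻¹ :=
    inv_anti₀ (sqrt_pos.2 hε) (sqrt_le_sqrt (by nlinarith [sq_nonneg ‖y‖]))
  have h2 := (sq_le_one_iff_abs_le_one _).2 (abs_coord_mul_inv_sqrt_le hε i y)
  rw [fderiv_coord_mul_inv_sqrt hε, abs_le]
  set s := (√(ε + ‖y‖ ^ 2))⁻¹
  constructor <;> nlinarith [mul_nonneg (sq_nonneg (y i * s)) hs.le, mul_le_mul_of_nonneg_right h2 hs.le]

lemma sum_fderiv_coord_mul_inv_sqrt_ge {ε : ℝ} (hε : 0 < ε) (y : E3) :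
    2 * (√(ε + ‖y‖ ^ 2))⁻¹ ≤
      ∑ i, fderiv ℝ (fun y : E3 ↦ y i * (√(ε + ‖y‖ ^ 2))⁻¹) y (EuclideanSpace.single i 1) := by
  have hpos : 0 < ε + ‖y‖ ^ 2 := by positivity
  have hs : 0 < √(ε + ‖y‖ ^ 2) := sqrt_pos.2 hpos
  have h1 := Real.sq_sqrt hpos.le
  have h2 : ‖y‖ ^ 2 = ∑ i, y i ^ 2 := EuclideanSpace.real_norm_sq_eq y
  simp only [fderiv_coord_mul_inv_sqrt hε, Finset.sum_sub_distrib, ← Finset.sum_mul, ← h2]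
  simp only [Finset.sum_const, Finset.card_univ, Fintype.card_fin, nsmul_eq_mul]
  set s := √(ε + ‖y‖ ^ 2)
  have : ‖y‖ ^ 2 * s⁻¹ ^ 3 ≤ s⁻¹ := by
    calc ‖y‖ ^ 2 * s⁻¹ ^ 3 ≤ s ^ 2 * s⁻¹ ^ 3 := by rw [h1]; gcongr; linarith
      _ = s⁻¹ := by field_simp
  push_cast
  linarith

lemma abs_sum_coord_mul_apply_le {ε : ℝ} (hε : 0 < ε) (L : E3 →L[ℝ] ℝ) (y : E3) :
    |∑ i, y i * (√(ε + ‖y‖ ^ 2))⁻¹ * L (EuclideanSpace.single i 1)| ≤ ‖L‖ := by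
  have hs : 0 < √(ε + ‖y‖ ^ 2) := sqrt_pos.2 (by positivity)
  have h : ∑ i, y i * (√(ε + ‖y‖ ^ 2))⁻¹ * L (EuclideanSpace.single i 1)
      = L ((√(ε + ‖y‖ ^ 2))⁻¹ • y) := by
    have hy : L y = ∑ i, y i * L (EuclideanSpace.single i 1) := by
      conv_lhs => rw [← (EuclideanSpace.basisFun (Fin 3) ℝ).sum_repr y]
      simp
    rw [map_smul, hy, smul_eq_mul, Finset.mul_sum]
    refine Finset.sum_congr rfl fun i _ ↦ by ring
  rw [h]
  refine (L.le_opNorm _).trans (mul_le_of_le_one_right (norm_nonneg _) ?_)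
  rw [norm_smul, norm_inv, Real.norm_of_nonneg hs.le, ← div_eq_inv_mul, div_le_one hs]
  exact Real.le_sqrt_of_sq_le (by linarith)

lemma integral_normSq_mul_inv_sqrt_le {u : E3 → ℂ} (hu : ContDiff ℝ 1 u)
    (h0 : Integrable fun x ↦ ‖u x‖ ^ 2) (h1 : Integrable fun x ↦ ‖fderiv ℝ u x‖ ^ 2)
    {ε : ℝ} (hε : 0 < ε) :
    Integrable (fun y ↦ ‖u y‖ ^ 2 * (√(ε + ‖y‖ ^ 2))⁻¹) ∧
    ∫ y, ‖u y‖ ^ 2 * (√(ε + ‖y‖ ^ 2))⁻¹ ≤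
      (∫ y, ‖fderiv ℝ u y‖ ^ 2) + (∫ y, ‖u y‖ ^ 2) / 4 := by
  have hpos (y : E3) : 0 < √(ε + ‖y‖ ^ 2) := sqrt_pos.2 (by positivity)
  have hcs : Continuous fun y : E3 ↦ (√(ε + ‖y‖ ^ 2))⁻¹ :=
    Continuous.inv₀ (by fun_prop) fun y ↦ (hpos y).ne'
  have hFc (i : Fin 3) : Continuous fun y : E3 ↦ y i * (√(ε + ‖y‖ ^ 2))⁻¹ :=
    Continuous.mul (by fun_prop) hcs
  have hFd (i : Fin 3) : Differentiable ℝ fun y : E3 ↦ y i * (√(ε + ‖y‖ ^ 2))⁻¹ :=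
    fun y ↦ (hasFDerivAt_coord_mul_inv_sqrt hε i y).differentiableAt
  have hg : ContDiff ℝ 1 fun y ↦ ‖u y‖ ^ 2 := hu.norm_sq ℝ
  have hgd : Differentiable ℝ fun y ↦ ‖u y‖ ^ 2 := hg.differentiable one_ne_zero
  have hgc : Continuous (fderiv ℝ fun y ↦ ‖u y‖ ^ 2) := hg.continuous_fderiv one_ne_zero
  have hgn (y : E3) : ‖fderiv ℝ (fun y ↦ ‖u y‖ ^ 2) y‖ ≤
      2 * (‖fderiv ℝ u y‖ ^ 2 + ‖u y‖ ^ 2 / 4) := by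
    have hd := ((hu.differentiable one_ne_zero y).hasFDerivAt).norm_sq
    have hd' : fderiv ℝ (fun y ↦ ‖u y‖ ^ 2) y = _ := hd.fderiv
    rw [hd']
    have : ‖(innerSL ℝ (u y)).comp (fderiv ℝ u y)‖ ≤ ‖u y‖ * ‖fderiv ℝ u y‖ :=
      (ContinuousLinearMap.opNorm_comp_le _ _).trans_eq (by rw [innerSL_apply_norm])
    calc _ ≤ 2 * (‖u y‖ * ‖fderiv ℝ u y‖) := by
          rw [two_smul, two_mul]; exact (norm_add_le _ _).trans (add_le_add this this)
      _ ≤ _ := by nlinarith [sq_nonneg (‖fderiv ℝ u y‖ - ‖u y‖ / 2)]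
  have hsum : Integrable fun y ↦ 2 * (‖fderiv ℝ u y‖ ^ 2 + ‖u y‖ ^ 2 / 4) :=
    (h1.add (h0.div_const 4)).const_mul 2
  have hi1 : Integrable fun y ↦ ‖u y‖ ^ 2 * (√(ε + ‖y‖ ^ 2))⁻¹ := by
    refine h0.mul_bdd (c := (√ε)⁻¹) hcs.aestronglyMeasurable (.of_forall fun y ↦ ?_)
    rw [norm_inv, Real.norm_of_nonneg (hpos y).le]
    exact inv_anti₀ (sqrt_pos.2 hε) (sqrt_le_sqrt (by nlinarith [sq_nonneg ‖y‖]))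
  have hfg (i : Fin 3) : Integrable fun y : E3 ↦ y i * (√(ε + ‖y‖ ^ 2))⁻¹ * ‖u y‖ ^ 2 :=
    h0.bdd_mul (c := 1) (hFc i).aestronglyMeasurable
      (.of_forall (abs_coord_mul_inv_sqrt_le hε i))
  have hf'g (i : Fin 3) : Integrable fun y : E3 ↦
      fderiv ℝ (fun y : E3 ↦ y i * (√(ε + ‖y‖ ^ 2))⁻¹) y (EuclideanSpace.single i 1) *
        ‖u y‖ ^ 2 := by
    refine h0.bdd_mul (c := (√ε)⁻¹) ?_ (.of_forall (abs_fderiv_coord_mul_inv_sqrt_le hε i))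
    simp only [fderiv_coord_mul_inv_sqrt hε]
    exact Continuous.aestronglyMeasurable (by fun_prop)
  have hfg' (i : Fin 3) : Integrable fun y : E3 ↦ y i * (√(ε + ‖y‖ ^ 2))⁻¹ *
      fderiv ℝ (fun y ↦ ‖u y‖ ^ 2) y (EuclideanSpace.single i 1) := by
    refine hsum.mono' (Continuous.aestronglyMeasurable ?_) (.of_forall fun y ↦ ?_)
    · exact (hFc i).mul (by fun_prop)
    · rw [norm_mul]
      refine (mul_le_of_le_one_left (norm_nonneg _) (abs_coord_mul_inv_sqrt_le hε i y)).trans ?_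
      refine (ContinuousLinearMap.le_opNorm _ _).trans ?_
      simpa using hgn y
  have hibp (i : Fin 3) := integral_mul_fderiv_eq_neg_fderiv_mul_of_integrable (μ := volume)
    (hf'g i) (hfg' i) (hfg i) (fun x _ ↦ hFd i x) (fun x _ ↦ hgd x)
  refine ⟨hi1, ?_⟩
  have hA : 2 * ∫ y, ‖u y‖ ^ 2 * (√(ε + ‖y‖ ^ 2))⁻¹ ≤
      ∑ i, ∫ y, fderiv ℝ (fun y : E3 ↦ y i * (√(ε + ‖y‖ ^ 2))⁻¹) y (EuclideanSpace.single i 1) *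
        ‖u y‖ ^ 2 := by
    rw [← integral_const_mul, ← integral_finsetSum _ fun i _ ↦ hf'g i]
    refine integral_mono (hi1.const_mul 2) (integrable_finsetSum _ fun i _ ↦ hf'g i) fun y ↦ ?_
    have := mul_le_mul_of_nonneg_right (sum_fderiv_coord_mul_inv_sqrt_ge hε y) (sq_nonneg ‖u y‖)
    simp only [← Finset.sum_mul]
    linarith
  have hB : -∑ i, ∫ y : E3, y i * (√(ε + ‖y‖ ^ 2))⁻¹ *
      fderiv ℝ (fun y ↦ ‖u y‖ ^ 2) y (EuclideanSpace.single i 1) ≤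
      ∫ y, 2 * (‖fderiv ℝ u y‖ ^ 2 + ‖u y‖ ^ 2 / 4) := by
    rw [← integral_finsetSum _ fun i _ ↦ hfg' i, ← integral_neg]
    refine integral_mono (integrable_finsetSum _ fun i _ ↦ hfg' i).neg hsum fun y ↦ ?_
    exact (neg_le_abs _).trans ((abs_sum_coord_mul_apply_le hε _ y).trans (hgn y))
  rw [integral_const_mul, integral_add h1 (h0.div_const 4), integral_div] at hB
  simp only [hibp, Finset.sum_neg_distrib, neg_neg] at hB
  linarith

lemma integral_normSq_div_norm_le {u : E3 → ℂ} (hu : ContDiff ℝ 1 u)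
    (h0 : Integrable fun x ↦ ‖u x‖ ^ 2) (h1 : Integrable fun x ↦ ‖fderiv ℝ u x‖ ^ 2) :
    Integrable (fun y ↦ ‖u y‖ ^ 2 / ‖y‖) ∧
    ∫ y, ‖u y‖ ^ 2 / ‖y‖ ≤ (∫ y, ‖fderiv ℝ u y‖ ^ 2) + (∫ y, ‖u y‖ ^ 2) / 4 := by
  set C := (∫ y, ‖fderiv ℝ u y‖ ^ 2) + (∫ y, ‖u y‖ ^ 2) / 4
  have hC : 0 ≤ C := add_nonneg (integral_nonneg fun _ ↦ by positivity)
    (div_nonneg (integral_nonneg fun _ ↦ by positivity) (by norm_num))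
  have hmeas : Measurable fun y ↦ ‖u y‖ ^ 2 / ‖y‖ :=
    (hu.continuous.measurable.norm.pow_const 2).div measurable_norm
  have hnn (y : E3) : 0 ≤ ‖u y‖ ^ 2 / ‖y‖ := by positivity
  have hlim : ∀ᵐ y : E3, Tendsto (fun n : ℕ ↦
      ENNReal.ofReal (‖u y‖ ^ 2 * (√(1 / ((n : ℝ) + 1) + ‖y‖ ^ 2))⁻¹)) atTop
      (𝓝 (ENNReal.ofReal (‖u y‖ ^ 2 / ‖y‖))) := by
    filter_upwards [compl_mem_ae_iff.2 (measure_singleton (0 : E3))] with y hy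
    refine (ENNReal.continuous_ofReal.tendsto _).comp ?_
    rw [div_eq_mul_inv]
    refine Tendsto.const_mul _ (Tendsto.inv₀ ?_ (norm_ne_zero_iff.2 hy))
    have := ((tendsto_one_div_add_atTop_nhds_zero_nat (𝕜 := ℝ)).add_const (‖y‖ ^ 2)).sqrt
    simpa using this
  have hle : ∫⁻ y, ENNReal.ofReal (‖u y‖ ^ 2 / ‖y‖) ≤ ENNReal.ofReal C := by
    calc _ = ∫⁻ y, liminf (fun n : ℕ ↦
          ENNReal.ofReal (‖u y‖ ^ 2 * (√(1 / ((n : ℝ) + 1) + ‖y‖ ^ 2))⁻¹)) atTop :=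
          lintegral_congr_ae (hlim.mono fun y hy ↦ hy.liminf_eq.symm)
      _ ≤ _ := lintegral_liminf_le fun n ↦ by
          have := hu.continuous.measurable
          fun_prop
      _ ≤ _ := by
          refine liminf_le_of_frequently_le' (Frequently.of_forall fun n ↦ ?_)
          obtain ⟨hi, hb⟩ := integral_normSq_mul_inv_sqrt_le hu h0 h1
            (ε := 1 / ((n : ℝ) + 1)) (by positivity)
          rw [← ofReal_integral_eq_lintegral_ofReal hi (.of_forall fun y ↦ by positivity)]
          exact ENNReal.ofReal_le_ofReal hb
  refine ⟨⟨hmeas.aestronglyMeasurable, ?_⟩, ?_⟩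
  · rw [hasFiniteIntegral_iff_ofReal (.of_forall hnn)]
    exact hle.trans_lt ENNReal.ofReal_lt_top
  · rw [integral_eq_lintegral_of_nonneg_ae (.of_forall hnn) hmeas.aestronglyMeasurable]
    exact ENNReal.toReal_le_of_le_ofReal hC hle

lemma integrable_normSq_schwartz (ψ : SchwartzMap E3 ℂ) : Integrable fun x ↦ ‖ψ x‖ ^ 2 :=
  (ψ.memLp 2).integrable_norm_pow two_ne_zero

lemma integrable_normSq_fderiv_schwartz (ψ : SchwartzMap E3 ℂ) :
    Integrable fun x ↦ ‖fderiv ℝ ψ x‖ ^ 2 := by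
  have h := (SchwartzMap.fderivCLM ℝ E3 ℂ ψ).memLp 2 (μ := volume)
  simpa only [SchwartzMap.fderivCLM_apply] using h.integrable_norm_pow two_ne_zero

lemma integral_coulomb_le (ψ : SchwartzMap E3 ℂ) (x : E3) :
    Integrable (fun y ↦ ‖ψ y‖ ^ 2 / ‖x - y‖) ∧
    ∫ y, ‖ψ y‖ ^ 2 / ‖x - y‖ ≤ (∫ y, ‖fderiv ℝ ψ y‖ ^ 2) + (∫ y, ‖ψ y‖ ^ 2) / 4 := by
  have hu : ContDiff ℝ 1 fun z ↦ ψ (x + z) := (ψ.smooth 1).comp (by fun_prop)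
  have hd (z : E3) : fderiv ℝ (fun z ↦ ψ (x + z)) z = fderiv ℝ ψ (x + z) :=
    fderiv_comp_add_left x
  obtain ⟨hi, hb⟩ := integral_normSq_div_norm_le hu
    ((integrable_normSq_schwartz ψ).comp_add_left x)
    (by simpa only [hd] using (integrable_normSq_fderiv_schwartz ψ).comp_add_left x)
  simp only [hd] at hb
  rw [integral_add_left_eq_self (fun y ↦ ‖fderiv ℝ ψ y‖ ^ 2),
    integral_add_left_eq_self (fun y ↦ ‖ψ y‖ ^ 2)] at hb
  have hc := hi.comp_sub_right x
  rw [← integral_sub_right_eq_self _ x] at hb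
  simp only [add_sub_cancel, norm_sub_rev _ x] at hc hb
  exact ⟨hc, hb⟩

lemma integral_coulomb_nonneg (ψ : SchwartzMap E3 ℂ) (x : E3) :
    0 ≤ ∫ y, ‖ψ y‖ ^ 2 / ‖x - y‖ := integral_nonneg fun _ ↦ by positivity

lemma pekarF_eq (ψ : SchwartzMap E3 ℂ) :
    pekarF ψ = (∫ x, ‖fderiv ℝ ψ x‖ ^ 2) - ∫ x, ‖ψ x‖ ^ 2 * ∫ y, ‖ψ y‖ ^ 2 / ‖x - y‖ := by
  simp only [pekarF, mul_div_assoc, integral_const_mul]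

lemma neg_quarter_le_pekarF (ψ : SchwartzMap E3 ℂ) (h : ∫ x, ‖ψ x‖ ^ 2 = 1) :
    -(1 / 4) ≤ pekarF ψ := by
  have hW : ∫ x, ‖ψ x‖ ^ 2 * ∫ y, ‖ψ y‖ ^ 2 / ‖x - y‖ ≤
      ∫ x, ‖ψ x‖ ^ 2 * ((∫ y, ‖fderiv ℝ ψ y‖ ^ 2) + (∫ y, ‖ψ y‖ ^ 2) / 4) :=
    integral_mono_of_nonneg
      (.of_forall fun x ↦ mul_nonneg (sq_nonneg _) (integral_coulomb_nonneg ψ x))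
      ((integrable_normSq_schwartz ψ).mul_const _)
      (.of_forall fun x ↦ mul_le_mul_of_nonneg_left (integral_coulomb_le ψ x).2 (sq_nonneg _))
  rw [integral_mul_const, h] at hW
  rw [pekarF_eq]
  linarith

lemma pekarF_le_of_support_subset_ball {ψ : SchwartzMap E3 ℂ} (h : ∫ x, ‖ψ x‖ ^ 2 = 1) {R : ℝ}
    (hsupp : ∀ x, ψ x ≠ 0 → ‖x‖ ≤ R) :
    pekarF ψ ≤ (∫ x, ‖fderiv ℝ ψ x‖ ^ 2) - (2 * R)⁻¹ := by
  have hm : Measurable ψ := ψ.continuous.measurable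
  have hV : AEStronglyMeasurable fun x ↦ ∫ y, ‖ψ y‖ ^ 2 / ‖x - y‖ := by
    refine (StronglyMeasurable.integral_prod_right
      (f := fun x y : E3 ↦ ‖ψ y‖ ^ 2 / ‖x - y‖) ?_).aestronglyMeasurable
    refine Measurable.stronglyMeasurable ?_
    exact ((hm.comp measurable_snd).norm.pow_const 2).div
      (measurable_fst.sub measurable_snd).norm
  have hi : Integrable fun x ↦ ‖ψ x‖ ^ 2 * ∫ y, ‖ψ y‖ ^ 2 / ‖x - y‖ :=
    (integrable_normSq_schwartz ψ).mul_bdd hV (.of_forall fun x ↦ by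
      rw [Real.norm_of_nonneg (integral_coulomb_nonneg ψ x)]
      exact (integral_coulomb_le ψ x).2)
  have hlow (x : E3) (hx : ψ x ≠ 0) : (2 * R)⁻¹ ≤ ∫ y, ‖ψ y‖ ^ 2 / ‖x - y‖ := by
    have h1 : ∫ y, ‖ψ y‖ ^ 2 * (2 * R)⁻¹ ≤ ∫ y, ‖ψ y‖ ^ 2 / ‖x - y‖ := by
      refine integral_mono_ae ((integrable_normSq_schwartz ψ).mul_const _)
        (integral_coulomb_le ψ x).1 ?_
      filter_upwards [compl_mem_ae_iff.2 (measure_singleton x)] with y hy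
      by_cases hy0 : ψ y = 0
      · simp [hy0]
      · have hxy : 0 < ‖x - y‖ := norm_pos_iff.2 (sub_ne_zero.2 (Ne.symm hy))
        rw [div_eq_mul_inv]
        gcongr
        linarith [norm_sub_le x y, hsupp x hx, hsupp y hy0]
    rwa [integral_mul_const, h, one_mul] at h1
  have hW : ∫ x, ‖ψ x‖ ^ 2 * (2 * R)⁻¹ ≤ ∫ x, ‖ψ x‖ ^ 2 * ∫ y, ‖ψ y‖ ^ 2 / ‖x - y‖ := by
    refine integral_mono ((integrable_normSq_schwartz ψ).mul_const _) hi fun x ↦ ?_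
    by_cases hx : ψ x = 0
    · simp [hx]
    · exact mul_le_mul_of_nonneg_left (hlow x hx) (sq_nonneg _)
  rw [integral_mul_const, h, one_mul] at hW
  rw [pekarF_eq]
  linarith

/-- There are normalized Schwartz functions supported in the ball of radius `R` whose kinetic
energy is a constant multiple of `R⁻²`. -/
lemma exists_schwartz_scaled :
    ∃ K : ℝ, ∀ R : ℝ, 0 < R → ∃ ψ : SchwartzMap E3 ℂ, ∫ x, ‖ψ x‖ ^ 2 = 1 ∧
      (∀ x, ψ x ≠ 0 → ‖x‖ ≤ R) ∧ ∫ x, ‖fderiv ℝ ψ x‖ ^ 2 = K / R ^ 2 := by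
  let b : ContDiffBump (0 : E3) := ⟨1 / 2, 1, by norm_num, by norm_num⟩
  let φ : E3 → ℂ := fun x ↦ (b x : ℂ)
  have hφ : ContDiff ℝ ∞ φ := Complex.ofRealCLM.contDiff.comp b.contDiff
  have hsupp : ∀ x, φ x ≠ 0 → ‖x‖ ≤ 1 := fun x hx ↦ by
    have : x ∈ Function.support b := by simpa [φ] using hx
    rw [b.support_eq] at this
    exact (mem_ball_zero_iff.1 this).le
  have hφc : HasCompactSupport φ := b.hasCompactSupport.comp_left Complex.ofReal_zero
  set N := ∫ x, ‖φ x‖ ^ 2 with hN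
  have hNpos : 0 < N := by
    refine Continuous.integral_pos_of_hasCompactSupport_nonneg_nonzero (x := 0)
      (hφ.continuous.norm.pow 2) ?_ (fun x ↦ by positivity) ?_
    · exact hφc.comp_left (g := fun z ↦ ‖z‖ ^ 2) (by simp)
    · have : b 0 = 1 := b.one_of_mem_closedBall (by simp [b])
      simp [φ, this]
  refine ⟨(∫ x, ‖fderiv ℝ φ x‖ ^ 2) / N, fun R hR ↦ ?_⟩
  set c : ℝ := (√(R ^ 3 * N))⁻¹ with hc
  have hc2 : c ^ 2 = (R ^ 3 * N)⁻¹ := by rw [hc, inv_pow, Real.sq_sqrt (by positivity)]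
  let f : E3 → ℂ := fun x ↦ c • φ (R⁻¹ • x)
  have hf : ContDiff ℝ ∞ f := (hφ.comp (contDiff_const_smul _)).const_smul c
  have hfc : HasCompactSupport f :=
    (hφc.comp_smul (inv_ne_zero hR.ne')).smul_left (f := fun _ ↦ c)
  have hfd (x : E3) : fderiv ℝ f x = c • R⁻¹ • fderiv ℝ φ (R⁻¹ • x) := by
    have h := fderiv_comp_smul (𝕜 := ℝ) (f := φ) (x := x) R⁻¹
    rw [← h]
    exact fderiv_fun_const_smul
      ((hφ.comp (contDiff_const_smul _)).differentiable (by simp) x) c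
  refine ⟨hfc.toSchwartzMap hf, ?_, fun x hx ↦ ?_, ?_⟩
  · change ∫ x, ‖f x‖ ^ 2 = 1
    simp only [f, norm_smul, mul_pow, Real.norm_eq_abs, sq_abs]
    rw [integral_const_mul, Measure.integral_comp_inv_smul_of_nonneg volume
      (fun x ↦ ‖φ x‖ ^ 2) hR.le, hc2, ← hN]
    simp
    field_simp
  · have h1 : φ (R⁻¹ • x) ≠ 0 := fun h ↦ hx (by change c • φ (R⁻¹ • x) = 0; simp [h])
    have h2 := hsupp _ h1
    rwa [norm_smul, norm_inv, Real.norm_of_nonneg hR.le, inv_mul_le_one₀ hR] at h2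
  · change ∫ x, ‖fderiv ℝ f x‖ ^ 2 = _
    simp only [hfd, norm_smul, mul_pow, Real.norm_eq_abs, sq_abs]
    rw [integral_const_mul, integral_const_mul, Measure.integral_comp_inv_smul_of_nonneg volume
      (fun x ↦ ‖fderiv ℝ φ x‖ ^ 2) hR.le, hc2]
    simp
    field_simp

/-- The Pekar energy is finite and strictly negative. -/
theorem pekar_energy_finite_neg : BddBelow pekarSet ∧ sInf pekarSet < 0 := by
  have hB : BddBelow pekarSet :=
    ⟨-(1 / 4), by rintro _ ⟨ψ, h, rfl⟩; exact neg_quarter_le_pekarF ψ h⟩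
  refine ⟨hB, ?_⟩
  obtain ⟨K, hK⟩ := exists_schwartz_scaled
  obtain ⟨R, hR, hKR⟩ : ∃ R : ℝ, 0 < R ∧ 2 * K < R :=
    ⟨2 * |K| + 1, by positivity, by linarith [le_abs_self K]⟩
  obtain ⟨ψ, h1, hsupp, hT⟩ := hK R hR
  refine (csInf_le hB ⟨ψ, h1, rfl⟩).trans_lt
    ((pekarF_le_of_support_subset_ball h1 hsupp).trans_lt ?_)
  have : K / R ^ 2 - (2 * R)⁻¹ = (2 * K - R) / (2 * R ^ 2) := by field_simp
  rw [hT, this]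
  exact div_neg_of_neg_of_pos (by linarith) (by positivity)

end
end

section
/- For every Schwartz function ψ : ℝ³ → ℂ, the Pekar field φ_ψ satisfies (2/3) ∫_{ℝ³} |∇φ_ψ(x)|² dx = (8π/3) ∫_{ℝ³} |ψ(x)|⁴ dx. -/
open MeasureTheory Real

noncomputable section

/-- The Pekar field `φ_ψ(x) = π^{−3/2} ∫ |ψ(y)|²/|x−y|² dy`. -/
def pekarField (ψ : SchwartzMap E3 ℂ) (x : E3) : ℝ :=
  π ^ (-(3 : ℝ) / 2) * ∫ y : E3, ‖ψ y‖ ^ 2 / ‖x - y‖ ^ 2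

open Set Filter Topology

/-- `1 / a` as a superposition of centred Gaussians in `a`. -/
lemma lintegral_two_mul_exp {a : ℝ} (ha : 0 < a) :
    ∫⁻ τ in Ioi (0 : ℝ), ENNReal.ofReal (2 * exp (-(π * τ ^ 2 * a ^ 2)))
      = ENNReal.ofReal (1 / a) := by
  have e : ∀ τ : ℝ, exp (-(π * τ ^ 2 * a ^ 2)) = exp (-(π * a ^ 2) * τ ^ 2) := fun τ => by
    congr 1; ring
  have hb : 0 < π * a ^ 2 := by positivity
  simp_rw [e]
  rw [← ofReal_integral_eq_lintegral_ofReal]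
  · rw [integral_const_mul, integral_gaussian_Ioi]
    congr 1
    rw [show π / (π * a ^ 2) = (1 / a) ^ 2 by field_simp, sqrt_sq (by positivity)]
    ring
  · exact ((integrable_exp_neg_mul_sq hb).const_mul 2).integrableOn
  · exact .of_forall fun τ => by positivity

/-- `1 / a` as a superposition of the exponentials `exp (-π τ² a)`. -/
lemma lintegral_mul_exp {a : ℝ} (ha : 0 < a) :
    ∫⁻ τ in Ioi (0 : ℝ), ENNReal.ofReal (2 * π * τ * exp (-(π * τ ^ 2 * a)))
      = ENNReal.ofReal (1 / a) := by
  have hder : ∀ τ ∈ Ici (0 : ℝ), HasDerivAt (fun τ : ℝ => -(1 / a) * exp (-(π * τ ^ 2 * a)))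
      (2 * π * τ * exp (-(π * τ ^ 2 * a))) τ := by
    intro τ _
    have h := ((((hasDerivAt_pow 2 τ).const_mul π).mul_const a).neg.exp).const_mul (-(1 / a))
    refine h.congr_deriv ?_
    simp
    field_simp
  have hlim : Tendsto (fun τ : ℝ => -(1 / a) * exp (-(π * τ ^ 2 * a))) atTop (𝓝 0) := by
    have : Tendsto (fun τ : ℝ => π * τ ^ 2 * a) atTop atTop :=
      ((tendsto_pow_atTop two_ne_zero).const_mul_atTop pi_pos).atTop_mul_const ha
    simpa using (tendsto_exp_neg_atTop_nhds_zero.comp this).const_mul (-(1 / a))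
  have hpos : ∀ τ ∈ Ioi (0 : ℝ), 0 ≤ 2 * π * τ * exp (-(π * τ ^ 2 * a)) := fun τ hτ => by
    have : 0 < τ := hτ
    positivity
  rw [← ofReal_integral_eq_lintegral_ofReal
    (integrableOn_Ioi_deriv_of_nonneg' hder hpos hlim)
    ((ae_restrict_iff' measurableSet_Ioi).2 (.of_forall hpos)),
    integral_Ioi_of_hasDerivAt_of_nonneg' hder hpos hlim]
  simp

/-- `1 / a` as a superposition of the exponentials `exp (-π a / τ²)`. -/
lemma lintegral_inv_pow_mul_exp {a : ℝ} (ha : 0 < a) :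
    ∫⁻ τ in Ioi (0 : ℝ), ENNReal.ofReal (2 * (τ ^ 3)⁻¹ * exp (-(π * a / τ ^ 2)))
      = ENNReal.ofReal (1 / (π * a)) := by
  set f : ℝ → ℝ := fun τ => if τ = 0 then 0 else (1 / (π * a)) * exp (-(π * a / τ ^ 2)) with hf
  have hb : 0 < π * a := by positivity
  have heq : ∀ τ : ℝ, τ ≠ 0 → f τ = (1 / (π * a)) * exp (-(π * a / τ ^ 2)) := fun τ hτ => by
    simp [hf, hτ]
  have hder : ∀ τ ∈ Ioi (0 : ℝ), HasDerivAt f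
      (2 * (τ ^ 3)⁻¹ * exp (-(π * a / τ ^ 2))) τ := by
    intro τ hτ
    have hτ0 : τ ≠ 0 := (show (0 : ℝ) < τ from hτ).ne'
    have h := (((hasDerivAt_pow 2 τ).fun_inv (pow_ne_zero 2 hτ0)).const_mul
      (π * a)).fun_neg.exp.const_mul (1 / (π * a))
    refine (h.congr_deriv ?_).congr_of_eventuallyEq ?_
    · simp only [div_eq_mul_inv]
      field_simp
      norm_num [mul_comm]
    · filter_upwards [isOpen_ne.mem_nhds hτ0] with t ht
      rw [heq t ht, div_eq_mul_inv (π * a)]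
  have hcont : ContinuousWithinAt f (Ici 0) 0 := by
    rw [← continuousWithinAt_Ioi_iff_Ici]
    have h0 : f 0 = 0 := by simp [hf]
    have hlim : Tendsto (fun τ : ℝ => (1 / (π * a)) * exp (-(π * a / τ ^ 2))) (𝓝[>] 0) (𝓝 0) := by
      have : Tendsto (fun τ : ℝ => π * a * (τ⁻¹) ^ 2) (𝓝[>] 0) atTop :=
        ((tendsto_pow_atTop two_ne_zero).comp tendsto_inv_nhdsGT_zero).const_mul_atTop hb
      simpa [div_eq_mul_inv, Function.comp_def] using
        (tendsto_exp_neg_atTop_nhds_zero.comp this).const_mul (1 / (π * a))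
    rw [ContinuousWithinAt, h0]
    refine hlim.congr' ?_
    filter_upwards [self_mem_nhdsWithin] with t ht
    rw [heq t (show (0 : ℝ) < t from ht).ne']
  have hlim : Tendsto f atTop (𝓝 (1 / (π * a))) := by
    have h : Tendsto (fun τ : ℝ => (1 / (π * a)) * exp (-(π * a / τ ^ 2))) atTop
        (𝓝 ((1 / (π * a)) * exp (-0))) := by
      refine ((continuous_exp.tendsto _).comp (Tendsto.neg ?_)).const_mul _
      exact (tendsto_pow_atTop two_ne_zero).const_div_atTop _
    simp only [neg_zero, exp_zero, mul_one] at h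
    refine h.congr' ?_
    filter_upwards [eventually_gt_atTop 0] with t ht
    rw [heq t ht.ne']
  have hpos : ∀ τ ∈ Ioi (0 : ℝ), 0 ≤ 2 * (τ ^ 3)⁻¹ * exp (-(π * a / τ ^ 2)) := fun τ hτ => by
    have : 0 < τ := hτ
    positivity
  rw [← ofReal_integral_eq_lintegral_ofReal
    (integrableOn_Ioi_deriv_of_nonneg hcont hder hpos hlim)
    ((ae_restrict_iff' measurableSet_Ioi).2 (.of_forall hpos)),
    integral_Ioi_of_hasDerivAt_of_nonneg hcont hder hpos hlim]
  simp [hf]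

/-- Completing the square in a product of two Gaussians. -/
lemma norm_sq_add_mul_norm_sub_sq {V : Type*} [NormedAddCommGroup V] [InnerProductSpace ℝ V]
    (q : ℝ) (x w : V) :
    ‖x‖ ^ 2 + q ^ 2 * ‖x - w‖ ^ 2
      = (1 + q ^ 2) * ‖x - (q ^ 2 / (1 + q ^ 2)) • w‖ ^ 2 + q ^ 2 / (1 + q ^ 2) * ‖w‖ ^ 2 := by
  have h : (1 + q ^ 2) ≠ 0 := by positivity
  rw [norm_sub_sq_real, norm_sub_sq_real, norm_smul, inner_smul_right, mul_pow, norm_eq_abs, sq_abs]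
  field_simp
  ring

lemma lintegral_exp_neg_mul_norm_sq {b : ℝ} (hb : 0 < b) (c : E3) :
    ∫⁻ x : E3, ENNReal.ofReal (exp (-(π * b ^ 2 * ‖x - c‖ ^ 2))) = ENNReal.ofReal ((b ^ 3)⁻¹) := by
  rw [lintegral_sub_right_eq_self (fun x : E3 => ENNReal.ofReal (exp (-(π * b ^ 2 * ‖x‖ ^ 2)))) c]
  have hb' : 0 < π * b ^ 2 := by positivity
  have h := GaussianFourier.integral_rexp_neg_mul_sq_norm (V := E3) hb'
  have hint : Integrable (fun x : E3 => exp (-(π * b ^ 2) * ‖x‖ ^ 2)) := by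
    by_contra hn
    rw [integral_undef hn] at h
    have : 0 < (π / (π * b ^ 2)) ^ ((Module.finrank ℝ E3 : ℝ) / 2) := by positivity
    exact this.ne h
  simp only [← neg_mul] at h ⊢
  simp only [← neg_mul] at hint
  rw [← ofReal_integral_eq_lintegral_ofReal hint (.of_forall fun x => (exp_pos _).le), h]
  congr 1
  rw [show π / (π * b ^ 2) = (b⁻¹) ^ (2 : ℝ) by
    rw [rpow_two]; field_simp, ← rpow_mul (by positivity)]
  norm_num

/-- The composition of two copies of the kernel `|x|⁻²` on `ℝ³` is `π³ |x|⁻¹`. -/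
lemma lintegral_inv_norm_sq_mul_inv_norm_sub_sq {w : E3} (hw : w ≠ 0) :
    ∫⁻ x : E3, ENNReal.ofReal (1 / (‖x‖ ^ 2 * ‖x - w‖ ^ 2)) = ENNReal.ofReal (π ^ 3 / ‖w‖) := by
  have hw' : 0 < ‖w‖ := norm_pos_iff.2 hw
  set F : E3 → ℝ → ℝ → ENNReal := fun x q σ =>
    ENNReal.ofReal (4 * π ^ 2 * σ ^ 3 * q * exp (-(π * σ ^ 2 * (‖x‖ ^ 2 + q ^ 2 * ‖x - w‖ ^ 2))))
    with hF
  have hmeas : Measurable fun p : E3 × ℝ × ℝ => F p.1 p.2.1 p.2.2 := by fun_prop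
  have hmeas' : Measurable fun p : E3 × ℝ => ∫⁻ σ in Ioi (0 : ℝ), F p.1 p.2 σ := by
    have h : Measurable fun p : (E3 × ℝ) × ℝ => F p.1.1 p.1.2 p.2 := by fun_prop
    exact h.lintegral_prod_right'
  have h1 : ∀ x : E3, x ≠ 0 → x ≠ w → ENNReal.ofReal (1 / (‖x‖ ^ 2 * ‖x - w‖ ^ 2)) =
      ∫⁻ q in Ioi (0 : ℝ), ∫⁻ σ in Ioi (0 : ℝ), F x q σ := by
    intro x hx hxw
    have hx' : 0 < ‖x‖ ^ 2 := by have := norm_pos_iff.2 hx; positivity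
    have hxw' : 0 < ‖x - w‖ ^ 2 := by have := norm_pos_iff.2 (sub_ne_zero.2 hxw); positivity
    rw [lintegral_lintegral_swap]
    swap
    · exact (hmeas.comp (measurable_const.prodMk measurable_id)).aemeasurable
    rw [one_div, mul_inv, ENNReal.ofReal_mul (by positivity), ← one_div, ← one_div,
      ← lintegral_mul_exp hx', ← lintegral_mul_const _ (by fun_prop)]
    refine setLIntegral_congr_fun measurableSet_Ioi fun σ hσ => ?_
    have hσ : 0 < σ := hσ
    have h2 := lintegral_mul_exp (a := σ ^ 2 * ‖x - w‖ ^ 2) (by positivity)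
    have h3 : ENNReal.ofReal (1 / ‖x - w‖ ^ 2) =
        ENNReal.ofReal (σ ^ 2) * ENNReal.ofReal (1 / (σ ^ 2 * ‖x - w‖ ^ 2)) := by
      rw [← ENNReal.ofReal_mul (by positivity)]
      congr 1
      field_simp
    rw [h3, ← h2, ← lintegral_const_mul _ (by fun_prop), ← lintegral_const_mul _ (by fun_prop)]
    refine setLIntegral_congr_fun measurableSet_Ioi fun q hq => ?_
    have hq : 0 < q := hq
    simp only [hF]
    rw [← ENNReal.ofReal_mul (by positivity), ← ENNReal.ofReal_mul (by positivity)]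
    congr 1
    rw [show -(π * σ ^ 2 * (‖x‖ ^ 2 + q ^ 2 * ‖x - w‖ ^ 2)) =
      -(π * σ ^ 2 * ‖x‖ ^ 2) + -(π * q ^ 2 * (σ ^ 2 * ‖x - w‖ ^ 2)) by ring, exp_add]
    ring
  have hae : ∀ᵐ x : E3, x ≠ 0 ∧ x ≠ w := by
    simp only [eventually_and]
    exact ⟨Measure.ae_ne volume 0, Measure.ae_ne volume w⟩
  rw [lintegral_congr_ae (hae.mono fun x hx => h1 x hx.1 hx.2), lintegral_lintegral_swap]
  swap
  · exact hmeas'.aemeasurable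
  have h2 : ∀ q ∈ Ioi (0 : ℝ), ∫⁻ x : E3, ∫⁻ σ in Ioi (0 : ℝ), F x q σ =
      ENNReal.ofReal (2 * π ^ 2 / ‖w‖ * (1 + q ^ 2)⁻¹) := by
    intro q hq
    have hq : 0 < q := hq
    set m := √(1 + q ^ 2)
    have hm0 : 0 < m := by positivity
    have hm2 : m ^ 2 = 1 + q ^ 2 := sq_sqrt (by positivity)
    rw [lintegral_lintegral_swap]
    swap
    · exact (hmeas.comp (by fun_prop : Measurable fun p : E3 × ℝ => (p.1, q, p.2))).aemeasurable
    have h3 : ∀ σ ∈ Ioi (0 : ℝ), ∫⁻ x : E3, F x q σ =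
        ENNReal.ofReal (2 * π ^ 2 * q / m ^ 3) *
          ENNReal.ofReal (2 * exp (-(π * σ ^ 2 * (q * ‖w‖ / m) ^ 2))) := by
      intro σ hσ
      have hσ : 0 < σ := hσ
      have h4 : ∀ x : E3, F x q σ = ENNReal.ofReal (4 * π ^ 2 * σ ^ 3 * q *
          exp (-(π * σ ^ 2 * (q * ‖w‖ / m) ^ 2))) *
          ENNReal.ofReal (exp (-(π * (σ * m) ^ 2 * ‖x - (q ^ 2 / (1 + q ^ 2)) • w‖ ^ 2))) := by
        intro x
        rw [← ENNReal.ofReal_mul (by positivity), mul_assoc _ (exp _), ← exp_add]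
        simp only [hF]
        rw [norm_sq_add_mul_norm_sub_sq, mul_pow, div_pow, hm2]
        congr 3
        ring
      rw [lintegral_congr h4, lintegral_const_mul _ (by fun_prop),
        lintegral_exp_neg_mul_norm_sq (by positivity), ← ENNReal.ofReal_mul (by positivity),
        ← ENNReal.ofReal_mul (by positivity)]
      congr 1
      field_simp
      ring
    rw [setLIntegral_congr_fun measurableSet_Ioi h3, lintegral_const_mul _ (by fun_prop),
      lintegral_two_mul_exp (by positivity), ← ENNReal.ofReal_mul (by positivity), ← hm2]
    congr 1
    field_simp
  rw [setLIntegral_congr_fun measurableSet_Ioi h2, ← ofReal_integral_eq_lintegral_ofReal,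
    integral_const_mul, integral_Ioi_inv_one_add_sq]
  · congr 1
    simp
    field_simp
  · exact (integrable_inv_one_add_sq.const_mul _).integrableOn
  · exact .of_forall fun q => by positivity

lemma lintegral_inv_norm_sub_sq_mul_inv_norm_sub_sq {y z : E3} (h : y ≠ z) :
    ∫⁻ x : E3, ENNReal.ofReal (1 / (‖x - y‖ ^ 2 * ‖x - z‖ ^ 2)) =
      ENNReal.ofReal (π ^ 3 / ‖y - z‖) := by
  rw [norm_sub_rev y z, ← lintegral_inv_norm_sq_mul_inv_norm_sub_sq (sub_ne_zero.2 h.symm),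
    ← lintegral_sub_right_eq_self
      (fun x : E3 => ENNReal.ofReal (1 / (‖x‖ ^ 2 * ‖x - (z - y)‖ ^ 2))) y]
  simp only [sub_sub_sub_cancel_right]

/-- Fubini's theorem for a nonnegative kernel `k` whose total mass is known. -/
lemma integral_mul_kernel_swap {α β : Type*} [MeasurableSpace α] [MeasurableSpace β]
    {μ : Measure α} {ν : Measure β} [SFinite μ] [SFinite ν] {K c : α → ℝ} {k : α → β → ℝ}
    (hK : AEStronglyMeasurable K μ) (hk : Measurable (Function.uncurry k))
    (hk0 : ∀ᵐ b ∂ν, ∀ a, 0 ≤ k a b)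
    (hc0 : ∀ a, 0 ≤ c a)
    (hkc : ∀ᵐ a ∂μ, ∫⁻ b, ENNReal.ofReal (k a b) ∂ν = ENNReal.ofReal (c a))
    (hc : Integrable (fun a => K a * c a) μ) :
    Integrable (fun b => ∫ a, K a * k a b ∂μ) ν ∧
      ∫ b, ∫ a, K a * k a b ∂μ ∂ν = ∫ a, K a * c a ∂μ := by
  have hk0' : ∀ a, 0 ≤ᵐ[ν] k a := fun a => hk0.mono fun b hb => hb a
  have hka : ∀ a, AEStronglyMeasurable (k a) ν := fun a =>
    (hk.comp measurable_prodMk_left).aestronglyMeasurable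
  have hi : ∀ᵐ a ∂μ, Integrable (k a) ν ∧ ∫ b, k a b ∂ν = c a := by
    filter_upwards [hkc] with a ha
    refine ⟨⟨hka a, ?_⟩, ?_⟩
    · rw [hasFiniteIntegral_iff_ofReal (hk0' a), ha]
      exact ENNReal.ofReal_lt_top
    · rw [integral_eq_lintegral_of_nonneg_ae (hk0' a) (hka a), ha, ENNReal.toReal_ofReal (hc0 a)]
  have hint : Integrable (fun p : α × β => K p.1 * k p.1 p.2) (μ.prod ν) := by
    have hKk : AEStronglyMeasurable (fun p : α × β => K p.1 * k p.1 p.2) (μ.prod ν) :=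
      hK.comp_fst.mul hk.aestronglyMeasurable
    refine (integrable_prod_iff hKk).2 ⟨hi.mono fun a ha => ha.1.const_mul (K a), hc.norm.congr ?_⟩
    filter_upwards [hi] with a ha
    simp only [norm_mul, norm_eq_abs]
    rw [integral_const_mul, abs_of_nonneg (hc0 a), ← ha.2]
    congr 1
    refine integral_congr_ae ((hk0' a).mono fun b hb => ?_)
    exact (abs_of_nonneg hb).symm
  refine ⟨hint.integral_prod_right, ?_⟩
  rw [← integral_integral_swap (f := fun a b => K a * k a b) hint]
  refine integral_congr_ae (hi.mono fun a ha => ?_)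
  simp only
  rw [integral_const_mul, ha.2]

lemma ae_fst_ne_snd : ∀ᵐ p : E3 × E3, p.1 ≠ p.2 := by
  rw [Measure.volume_eq_prod, Measure.ae_prod_iff_ae_ae]
  · exact .of_forall fun x => (Measure.ae_ne volume x).mono fun y hy => hy.symm
  · exact (measurableSet_eq_fun measurable_fst measurable_snd).compl

lemma integrable_inv_norm_sq_mul_inv_one_add_norm_sq :
    Integrable fun h : E3 => 1 / (‖h‖ ^ 2 * (1 + ‖h‖ ^ 2)) := by
  refine (integrable_fun_norm_addHaar volume (f := fun y : ℝ => 1 / (y ^ 2 * (1 + y ^ 2)))).2 ?_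
  refine integrable_inv_one_add_sq.integrableOn.congr_fun (fun y hy => ?_) measurableSet_Ioi
  have hy : 0 < y := hy
  simp
  field_simp

lemma SchwartzMap.exists_one_add_norm_sq_mul_le {F : Type*} [NormedAddCommGroup F]
    [NormedSpace ℝ F] (f : SchwartzMap E3 F) :
    ∃ C, 0 ≤ C ∧ ∀ x, (1 + ‖x‖ ^ 2) * ‖f x‖ ≤ C := by
  obtain ⟨C₀, -, h₀⟩ := f.decay 0 0
  obtain ⟨C₂, -, h₂⟩ := f.decay 2 0
  have h : ∀ x, (1 + ‖x‖ ^ 2) * ‖f x‖ ≤ C₀ + C₂ := fun x => by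
    have h0 := h₀ x
    have h2 := h₂ x
    simp only [pow_zero, one_mul, norm_iteratedFDeriv_zero] at h0 h2
    linarith
  exact ⟨C₀ + C₂, (by positivity : 0 ≤ (1 + ‖(0 : E3)‖ ^ 2) * ‖f 0‖).trans (h 0), h⟩

lemma SchwartzMap.exists_norm_sub_le {F : Type*} [NormedAddCommGroup F]
    [NormedSpace ℝ F] (f : SchwartzMap E3 F) (R : ℝ) :
    ∃ C, ∀ x h, ‖x‖ ≤ R → 1 / ‖h‖ ^ 2 * ‖f (x - h)‖ ≤ C * (1 / (‖h‖ ^ 2 * (1 + ‖h‖ ^ 2))) := by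
  obtain ⟨C, hC, hf⟩ := f.exists_one_add_norm_sq_mul_le
  refine ⟨2 * (1 + R ^ 2) * C, fun x h hx => ?_⟩
  have h1 : 1 + ‖h‖ ^ 2 ≤ 2 * (1 + R ^ 2) * (1 + ‖x - h‖ ^ 2) := by
    have h2 : ‖h‖ ≤ R + ‖x - h‖ := by
      have h3 := norm_sub_le x (x - h)
      rw [sub_sub_cancel] at h3
      linarith
    have h3 := norm_nonneg h
    have h4 : ‖h‖ ^ 2 ≤ (R + ‖x - h‖) ^ 2 := by gcongr
    nlinarith [sq_nonneg (R - ‖x - h‖), sq_nonneg (R * ‖x - h‖)]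
  have h2 : ‖f (x - h)‖ ≤ 2 * (1 + R ^ 2) * C / (1 + ‖h‖ ^ 2) := by
    rw [le_div_iff₀ (by positivity)]
    calc ‖f (x - h)‖ * (1 + ‖h‖ ^ 2)
        ≤ ‖f (x - h)‖ * (2 * (1 + R ^ 2) * (1 + ‖x - h‖ ^ 2)) := by gcongr
      _ = 2 * (1 + R ^ 2) * ((1 + ‖x - h‖ ^ 2) * ‖f (x - h)‖) := by ring
      _ ≤ _ := by gcongr; exact hf _
  calc _ ≤ 1 / ‖h‖ ^ 2 * (2 * (1 + R ^ 2) * C / (1 + ‖h‖ ^ 2)) := by gcongr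
    _ = _ := by simp only [div_eq_mul_inv, mul_inv]; ring

lemma integrable_mul_inv_norm_sub (f : SchwartzMap E3 ℝ) :
    Integrable fun p : E3 × E3 => f p.1 * f p.2 * (1 / ‖p.1 - p.2‖) := by
  obtain ⟨C, hC, hf⟩ := f.exists_one_add_norm_sq_mul_le
  have hfC : ∀ x, ‖f x‖ ≤ C := fun x => by
    nlinarith [hf x, norm_nonneg (f x), mul_nonneg (sq_nonneg ‖x‖) (norm_nonneg (f x))]
  have hfi : Integrable (f : E3 → ℝ) := f.integrable
  have h1 : Integrable fun p : E3 × E3 => ‖f p.1‖ * ‖f p.2‖ := hfi.norm.mul_prod hfi.norm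
  have h2 : Integrable fun p : E3 × E3 =>
      ‖f p.2‖ * (1 / (‖p.1 - p.2‖ ^ 2 * (1 + ‖p.1 - p.2‖ ^ 2))) :=
    hfi.norm.convolution_integrand (ContinuousLinearMap.mul ℝ ℝ)
      integrable_inv_norm_sq_mul_inv_one_add_norm_sq
  refine (h1.add (h2.const_mul (2 * C))).mono' ?_ (.of_forall fun p => ?_)
  · have := f.continuous.measurable
    exact Measurable.aestronglyMeasurable (by fun_prop)
  · set r := ‖p.1 - p.2‖
    have hr : 0 ≤ r := norm_nonneg _
    have hk : 1 / r ≤ 1 + 2 * (1 / (r ^ 2 * (1 + r ^ 2))) := by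
      rcases hr.eq_or_lt with h | h
      · simp [← h]
      rcases le_total r 1 with h1 | h1
      · have : 1 / r ≤ 2 * (1 / (r ^ 2 * (1 + r ^ 2))) := by
          rw [mul_one_div, div_le_div_iff₀ h (by positivity)]
          have h2 : r ^ 2 ≤ r := by nlinarith
          have h3 : 1 + r ^ 2 ≤ 2 := by nlinarith
          nlinarith [mul_le_mul h2 h3 (by positivity) hr]
        linarith
      · have : 1 / r ≤ 1 := by rw [div_le_one h]; exact h1
        have : 0 ≤ 2 * (1 / (r ^ 2 * (1 + r ^ 2))) := by positivity
        linarith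
    simp only [Pi.add_apply]
    rw [norm_mul, norm_mul, norm_of_nonneg (by positivity : 0 ≤ 1 / r)]
    calc ‖f p.1‖ * ‖f p.2‖ * (1 / r)
        ≤ ‖f p.1‖ * ‖f p.2‖ * (1 + 2 * (1 / (r ^ 2 * (1 + r ^ 2)))) := by gcongr
      _ = ‖f p.1‖ * ‖f p.2‖ + 2 * ‖f p.1‖ * (‖f p.2‖ * (1 / (r ^ 2 * (1 + r ^ 2)))) := by ring
      _ ≤ _ := by gcongr; exact hfC _

/-- The square of the Riesz potential of order one has the Newtonian energy as its integral. -/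
lemma integral_sq_integral_mul_inv_norm_sub_sq (f : SchwartzMap E3 ℝ) :
    Integrable (fun x : E3 => (∫ y, f y * (1 / ‖x - y‖ ^ 2)) ^ 2) ∧
      ∫ x : E3, (∫ y, f y * (1 / ‖x - y‖ ^ 2)) ^ 2 =
        π ^ 3 * ∫ p : E3 × E3, f p.1 * f p.2 * (1 / ‖p.1 - p.2‖) := by
  have hm := f.continuous.measurable
  have h := integral_mul_kernel_swap (μ := (volume : Measure (E3 × E3)))
    (ν := (volume : Measure E3)) (K := fun p : E3 × E3 => f p.1 * f p.2)
    (c := fun p => π ^ 3 / ‖p.1 - p.2‖)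
    (k := fun p x => 1 / (‖x - p.1‖ ^ 2 * ‖x - p.2‖ ^ 2))
    (Measurable.aestronglyMeasurable (by fun_prop)) (by fun_prop)
    (.of_forall fun x p => by positivity) (fun p => by positivity)
    (ae_fst_ne_snd.mono fun p hp => lintegral_inv_norm_sub_sq_mul_inv_norm_sub_sq hp)
    (((integrable_mul_inv_norm_sub f).const_mul (π ^ 3)).congr (.of_forall fun p => by
      simp only; ring))
  have e : ∀ x : E3, ∫ p : E3 × E3, f p.1 * f p.2 * (1 / (‖x - p.1‖ ^ 2 * ‖x - p.2‖ ^ 2)) =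
      (∫ y, f y * (1 / ‖x - y‖ ^ 2)) ^ 2 := by
    intro x
    rw [sq, ← integral_prod_mul (μ := volume) (ν := volume) (fun y : E3 => f y * (1 / ‖x - y‖ ^ 2))
      (fun y : E3 => f y * (1 / ‖x - y‖ ^ 2))]
    refine integral_congr_ae (.of_forall fun p => ?_)
    simp only [div_eq_mul_inv, mul_inv]
    ring
  simp only [e] at h
  refine ⟨h.1, h.2.trans ?_⟩
  rw [← integral_const_mul]
  refine integral_congr_ae (.of_forall fun p => ?_)
  simp only
  ring

open scoped FourierTransform ComplexConjugate RealInnerProductSpace SchwartzMap LineDeriv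

lemma integrable_cexp_neg_mul_norm_sq {b : ℝ} (hb : 0 < b) :
    Integrable fun v : E3 => Complex.exp (-(b : ℂ) * (‖v‖ : ℂ) ^ 2) := by
  have := GaussianFourier.integrable_cexp_neg_mul_sq_norm_add (V := E3) (b := (b : ℂ))
    (by simpa using hb) 0 0
  simpa using this

/-- Gaussian-weighted Plancherel identity. -/
lemma integral_norm_sq_fourier_mul_gaussian_complex (F : 𝓢(E3, ℂ)) {τ : ℝ} (hτ : 0 < τ) :
    ∫ k : E3, ((‖𝓕 F k‖ ^ 2 : ℝ) : ℂ) * Complex.exp (-((π / τ ^ 2 : ℝ) : ℂ) * (‖k‖ : ℂ) ^ 2) =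
      ∫ p : E3 × E3, F p.1 * conj (F p.2) *
        ((τ ^ 3 * exp (-(π * τ ^ 2 * ‖p.1 - p.2‖ ^ 2)) : ℝ) : ℂ) := by
  have hb : 0 < π / τ ^ 2 := by positivity
  set g : E3 → ℂ := fun k => Complex.exp (-((π / τ ^ 2 : ℝ) : ℂ) * (‖k‖ : ℂ) ^ 2)
  have hgi : Integrable g := integrable_cexp_neg_mul_norm_sq hb
  have hFc := F.continuous
  have hFi : Integrable (F : E3 → ℂ) := F.integrable
  have hFi' : Integrable fun x : E3 => conj (F x) :=
    hFi.norm.mono' (by fun_prop) (.of_forall fun x => by simp)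
  have hKi : Integrable fun p : E3 × E3 => F p.1 * conj (F p.2) := hFi.mul_prod hFi'
  have h1 : ∀ k : E3, ((‖𝓕 F k‖ ^ 2 : ℝ) : ℂ) * g k = ∫ p : E3 × E3,
      Complex.exp (((-2 * π * ⟪k, p.1 - p.2⟫ : ℝ) : ℂ) * Complex.I) * g k *
        (F p.1 * conj (F p.2)) := by
    intro k
    rw [Complex.ofReal_pow, ← Complex.mul_conj', SchwartzMap.fourier_coe, Real.fourier_eq',
      ← integral_conj, ← integral_prod_mul, mul_comm, ← integral_const_mul]
    refine integral_congr_ae (.of_forall fun p => ?_)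
    simp only [smul_eq_mul, map_mul, ← Complex.exp_conj, Complex.conj_ofReal, Complex.conj_I]
    rw [inner_sub_right, real_inner_comm p.1 k, real_inner_comm p.2 k,
      show ((-2 * π * (⟪p.1, k⟫ - ⟪p.2, k⟫) : ℝ) : ℂ) * Complex.I =
        ((-2 * π * ⟪p.1, k⟫ : ℝ) : ℂ) * Complex.I + ((-2 * π * ⟪p.2, k⟫ : ℝ) : ℂ) * -Complex.I by
      push_cast; ring, Complex.exp_add]
    ring
  have h2 : ∀ p : E3 × E3, ∫ k : E3,
      Complex.exp (((-2 * π * ⟪k, p.1 - p.2⟫ : ℝ) : ℂ) * Complex.I) * g k *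
        (F p.1 * conj (F p.2)) = F p.1 * conj (F p.2) *
        ((τ ^ 3 * exp (-(π * τ ^ 2 * ‖p.1 - p.2‖ ^ 2)) : ℝ) : ℂ) := by
    intro p
    rw [integral_mul_const, mul_comm]
    congr 1
    have h := fourier_gaussian_innerProductSpace (V := E3) (b := ((π / τ ^ 2 : ℝ) : ℂ))
      (by rw [Complex.ofReal_re]; exact hb) (p.1 - p.2)
    rw [Real.fourier_eq'] at h
    simp only [smul_eq_mul] at h
    refine h.trans ?_
    have e1 : (π : ℂ) / ((π / τ ^ 2 : ℝ) : ℂ) = ((τ ^ 2 : ℝ) : ℂ) := by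
      rw [← Complex.ofReal_div]; congr 1; field_simp
    have e2 : (Module.finrank ℝ E3 / 2 : ℂ) = ((3 / 2 : ℝ) : ℂ) := by simp
    have e3 : (τ ^ 2) ^ (3 / 2 : ℝ) = τ ^ 3 := by
      rw [← rpow_two, ← rpow_mul hτ.le]; norm_num
    rw [e1, e2, ← Complex.ofReal_cpow (by positivity), e3, Complex.ofReal_mul, Complex.ofReal_exp]
    congr 2
    rw [← Complex.ofReal_pow, ← Complex.ofReal_pow, ← Complex.ofReal_neg, ← Complex.ofReal_mul,
      ← Complex.ofReal_div]
    congr 1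
    field_simp
  have hint : Integrable (fun q : E3 × E3 × E3 =>
      Complex.exp (((-2 * π * ⟪q.1, q.2.1 - q.2.2⟫ : ℝ) : ℂ) * Complex.I) * g q.1 *
        (F q.2.1 * conj (F q.2.2))) := by
    refine (hgi.mul_prod hKi).mono (Continuous.aestronglyMeasurable (by fun_prop))
      (.of_forall fun q => ?_)
    simp only [norm_mul, Complex.norm_exp_ofReal_mul_I, one_mul, le_refl]
  calc _ = _ := integral_congr_ae (.of_forall h1)
    _ = _ := integral_integral_swap hint
    _ = _ := integral_congr_ae (.of_forall h2)

/-- The complexification of a real-valued Schwartz function. -/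
def complexify (f : 𝓢(E3, ℝ)) : 𝓢(E3, ℂ) := f.postcompCLM Complex.ofRealCLM

lemma complexify_apply (f : 𝓢(E3, ℝ)) (x : E3) : complexify f x = f x := rfl

lemma integral_norm_sq_fourier_mul_gaussian (f : 𝓢(E3, ℝ)) {τ : ℝ} (hτ : 0 < τ) :
    ∫ k : E3, ‖𝓕 (complexify f) k‖ ^ 2 * (2 * (τ ^ 3)⁻¹ * exp (-(π * ‖k‖ ^ 2 / τ ^ 2))) =
      ∫ p : E3 × E3, f p.1 * f p.2 * (2 * exp (-(π * τ ^ 2 * ‖p.1 - p.2‖ ^ 2))) := by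
  have h := integral_norm_sq_fourier_mul_gaussian_complex (complexify f) hτ
  have e1 : ∀ k : E3, ((‖𝓕 (complexify f) k‖ ^ 2 : ℝ) : ℂ) *
      Complex.exp (-((π / τ ^ 2 : ℝ) : ℂ) * (‖k‖ : ℂ) ^ 2) =
      ((‖𝓕 (complexify f) k‖ ^ 2 * exp (-(π * ‖k‖ ^ 2 / τ ^ 2)) : ℝ) : ℂ) := fun k => by
    push_cast
    congr 2
    ring
  have e2 : ∀ p : E3 × E3, complexify f p.1 * conj (complexify f p.2) *
        ((τ ^ 3 * exp (-(π * τ ^ 2 * ‖p.1 - p.2‖ ^ 2)) : ℝ) : ℂ) =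
      ((f p.1 * f p.2 * (τ ^ 3 * exp (-(π * τ ^ 2 * ‖p.1 - p.2‖ ^ 2))) : ℝ) : ℂ) := fun p => by
    simp only [complexify_apply, Complex.conj_ofReal]
    push_cast
    ring
  simp_rw [e1, e2] at h
  rw [integral_complex_ofReal, integral_complex_ofReal, Complex.ofReal_inj] at h
  have h' := congrArg (fun t => 2 * (τ ^ 3)⁻¹ * t) h
  simp only [← integral_const_mul] at h'
  refine (integral_congr_ae (.of_forall fun k => ?_)).trans
    (h'.trans (integral_congr_ae (.of_forall fun p => ?_)))
  · ring
  · simp only; field_simp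

/-- The Newtonian energy in Fourier space. -/
lemma integral_mul_inv_norm_sub_eq_fourier (f : 𝓢(E3, ℝ)) :
    Integrable (fun k : E3 => ‖𝓕 (complexify f) k‖ ^ 2 * (1 / (π * ‖k‖ ^ 2))) ∧
      ∫ p : E3 × E3, f p.1 * f p.2 * (1 / ‖p.1 - p.2‖) =
        ∫ k : E3, ‖𝓕 (complexify f) k‖ ^ 2 * (1 / (π * ‖k‖ ^ 2)) := by
  have hm := f.continuous.measurable
  have hm' := (𝓕 (complexify f)).continuous.measurable
  have hi : Integrable (fun k : E3 => ‖𝓕 (complexify f) k‖ ^ 2 * (1 / (π * ‖k‖ ^ 2))) := by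
    obtain ⟨C, hC, h⟩ := (𝓕 (complexify f)).exists_one_add_norm_sq_mul_le
    refine (integrable_inv_norm_sq_mul_inv_one_add_norm_sq.const_mul (C ^ 2 / π)).mono'
      (Measurable.aestronglyMeasurable (by fun_prop)) (.of_forall fun k => ?_)
    rw [norm_of_nonneg (by positivity)]
    have h1 : ‖𝓕 (complexify f) k‖ ^ 2 ≤ C ^ 2 / (1 + ‖k‖ ^ 2) := by
      rw [le_div_iff₀ (by positivity)]
      calc ‖𝓕 (complexify f) k‖ ^ 2 * (1 + ‖k‖ ^ 2)
          ≤ ‖𝓕 (complexify f) k‖ ^ 2 * (1 + ‖k‖ ^ 2) ^ 2 := by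
            gcongr
            exact le_self_pow₀ (by nlinarith [sq_nonneg ‖k‖]) two_ne_zero
        _ = ((1 + ‖k‖ ^ 2) * ‖𝓕 (complexify f) k‖) ^ 2 := by ring
        _ ≤ C ^ 2 := by gcongr; exact h k
    calc _ ≤ C ^ 2 / (1 + ‖k‖ ^ 2) * (1 / (π * ‖k‖ ^ 2)) := by gcongr
      _ = _ := by simp only [div_eq_mul_inv, mul_inv]; ring
  have hpos : ∀ᵐ τ : ℝ ∂volume.restrict (Ioi 0), 0 < τ := ae_restrict_mem measurableSet_Ioi
  have h1 := integral_mul_kernel_swap (μ := (volume : Measure (E3 × E3)))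
    (ν := volume.restrict (Ioi (0 : ℝ))) (K := fun p : E3 × E3 => f p.1 * f p.2)
    (c := fun p => 1 / ‖p.1 - p.2‖)
    (k := fun p τ => 2 * exp (-(π * τ ^ 2 * ‖p.1 - p.2‖ ^ 2)))
    (Measurable.aestronglyMeasurable (by fun_prop)) (by fun_prop)
    (.of_forall fun x p => by positivity) (fun p => by positivity)
    (ae_fst_ne_snd.mono fun p hp =>
      lintegral_two_mul_exp (norm_pos_iff.2 (sub_ne_zero.2 hp)))
    (integrable_mul_inv_norm_sub f)
  have h2 := integral_mul_kernel_swap (μ := (volume : Measure E3))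
    (ν := volume.restrict (Ioi (0 : ℝ))) (K := fun k : E3 => ‖𝓕 (complexify f) k‖ ^ 2)
    (c := fun k => 1 / (π * ‖k‖ ^ 2))
    (k := fun k τ => 2 * (τ ^ 3)⁻¹ * exp (-(π * ‖k‖ ^ 2 / τ ^ 2)))
    (Measurable.aestronglyMeasurable (by fun_prop)) (by fun_prop)
    (hpos.mono fun τ hτ k => by positivity) (fun p => by positivity)
    ((Measure.ae_ne volume 0).mono fun k hk => lintegral_inv_pow_mul_exp
      (by have := norm_pos_iff.2 hk; positivity)) hi
  refine ⟨hi, ?_⟩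
  rw [← h1.2, ← h2.2]
  exact integral_congr_ae (hpos.mono fun τ hτ =>
    (integral_norm_sq_fourier_mul_gaussian f hτ).symm)

lemma aestronglyMeasurable_inv_norm_sq_smul_fderiv (f : 𝓢(E3, ℝ)) (x : E3) :
    AEStronglyMeasurable fun h : E3 => (1 / ‖h‖ ^ 2) • fderiv ℝ f (x - h) := by
  have hw : Measurable fun h : E3 => 1 / ‖h‖ ^ 2 := by fun_prop
  have hd : Continuous (fderiv ℝ f) := (SchwartzMap.fderivCLM ℝ E3 ℝ f).continuous
  have hs : Continuous fun h : E3 => x - h := by fun_prop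
  exact hw.aestronglyMeasurable.smul (hd.comp hs).aestronglyMeasurable

/-- The Riesz potential of a Schwartz function is differentiable, and the derivative falls on the
Schwartz function. -/
lemma hasFDerivAt_integral_inv_norm_sq (f : 𝓢(E3, ℝ)) (x : E3) :
    HasFDerivAt (fun x : E3 => ∫ y, f y * (1 / ‖x - y‖ ^ 2))
      (∫ h : E3, (1 / ‖h‖ ^ 2) • fderiv ℝ f (x - h)) x := by
  have e : (fun x : E3 => ∫ y, f y * (1 / ‖x - y‖ ^ 2)) =
      fun x : E3 => ∫ h : E3, (1 / ‖h‖ ^ 2) • f (x - h) := by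
    funext x
    rw [← integral_sub_left_eq_self _ volume x]
    simp [mul_comm]
  rw [e]
  have hfc := f.continuous.measurable
  have hw : ∀ h : E3, ‖(1 / ‖h‖ ^ 2 : ℝ)‖ = 1 / ‖h‖ ^ 2 := fun h =>
    norm_of_nonneg (by positivity)
  have hmeas : ∀ x : E3, AEStronglyMeasurable (fun h : E3 => (1 / ‖h‖ ^ 2) • f (x - h)) := fun x =>
    Measurable.aestronglyMeasurable (by fun_prop)
  obtain ⟨C, hC⟩ := f.exists_norm_sub_le ‖x‖
  obtain ⟨D, hD⟩ := (SchwartzMap.fderivCLM ℝ E3 ℝ f).exists_norm_sub_le (‖x‖ + 1)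
  refine hasFDerivAt_integral_of_dominated_of_fderiv_le
    (F' := fun x h => (1 / ‖h‖ ^ 2) • fderiv ℝ f (x - h))
    (bound := fun h => D * (1 / (‖h‖ ^ 2 * (1 + ‖h‖ ^ 2)))) (Metric.ball_mem_nhds x one_pos)
    (.of_forall hmeas) ?_ ?_ ?_ ?_ ?_
  · refine (integrable_inv_norm_sq_mul_inv_one_add_norm_sq.const_mul C).mono' (hmeas x)
      (.of_forall fun h => ?_)
    rw [norm_smul, hw]
    exact hC x h le_rfl
  · exact aestronglyMeasurable_inv_norm_sq_smul_fderiv f x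
  · refine .of_forall fun h z hz => ?_
    rw [norm_smul, hw]
    refine hD z h ?_
    have h1 := norm_sub_norm_le z x
    rw [Metric.mem_ball, dist_eq_norm] at hz
    linarith
  · exact integrable_inv_norm_sq_mul_inv_one_add_norm_sq.const_mul D
  · refine .of_forall fun h z _ => ?_
    have h1 : HasFDerivAt (fun z : E3 => f (z - h)) (fderiv ℝ f (z - h)) z := by
      simpa using! (f.hasFDerivAt (z - h)).comp z ((hasFDerivAt_id z).sub_const h)
    exact h1.fun_const_smul _

lemma fderiv_integral_inv_norm_sq_apply (f : 𝓢(E3, ℝ)) (x v : E3) :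
    fderiv ℝ (fun x : E3 => ∫ y, f y * (1 / ‖x - y‖ ^ 2)) x v =
      ∫ y, (∂_{v} f) y * (1 / ‖x - y‖ ^ 2) := by
  have hint : Integrable fun h : E3 => (1 / ‖h‖ ^ 2) • fderiv ℝ f (x - h) := by
    obtain ⟨D, hD⟩ := (SchwartzMap.fderivCLM ℝ E3 ℝ f).exists_norm_sub_le ‖x‖
    refine (integrable_inv_norm_sq_mul_inv_one_add_norm_sq.const_mul D).mono'
      (aestronglyMeasurable_inv_norm_sq_smul_fderiv f x) (.of_forall fun h => ?_)
    rw [norm_smul, norm_of_nonneg (by positivity)]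
    exact hD x h le_rfl
  rw [(hasFDerivAt_integral_inv_norm_sq f x).fderiv, ContinuousLinearMap.integral_apply hint,
    ← integral_sub_left_eq_self _ volume x]
  simp [mul_comm, SchwartzMap.lineDerivOp_apply_eq_fderiv]

/-- The Dirichlet energy of the Riesz potential of a Schwartz function. -/
lemma integral_norm_gradient_sq (f : 𝓢(E3, ℝ)) :
    ∫ x : E3, ‖gradient (fun x : E3 => ∫ y, f y * (1 / ‖x - y‖ ^ 2)) x‖ ^ 2 =
      4 * π ^ 4 * ∫ x : E3, f x ^ 2 := by
  set b := EuclideanSpace.basisFun (Fin 3) ℝ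
  have hgrad : ∀ x : E3, ‖gradient (fun x : E3 => ∫ y, f y * (1 / ‖x - y‖ ^ 2)) x‖ ^ 2 =
      ∑ i, (∫ y, (∂_{b i} f) y * (1 / ‖x - y‖ ^ 2)) ^ 2 := fun x => by
    rw [← b.sum_sq_norm_inner_left]
    refine Finset.sum_congr rfl fun i _ => ?_
    rw [norm_eq_abs, sq_abs, gradient, InnerProductSpace.toDual_symm_apply,
      fderiv_integral_inv_norm_sq_apply]
  have hfour : ∀ i (k : E3), ‖𝓕 (complexify (∂_{b i} f)) k‖ ^ 2 =
      4 * π ^ 2 * ⟪k, b i⟫ ^ 2 * ‖𝓕 (complexify f) k‖ ^ 2 := fun i k => by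
    have e : complexify (∂_{b i} f) = ∂_{b i} (complexify f) := by
      ext x
      rw [complexify_apply, SchwartzMap.lineDerivOp_apply_eq_fderiv,
        SchwartzMap.lineDerivOp_apply_eq_fderiv]
      have h := (Complex.ofRealCLM.hasFDerivAt (x := f x)).comp x (f.hasFDerivAt x)
      rw [show (complexify f : E3 → ℂ) = Complex.ofRealCLM ∘ f from rfl, h.fderiv]
      rfl
    have ht : (fun k : E3 => ⟪k, b i⟫).HasTemperateGrowth :=
      ((innerSL ℝ).flip (b i)).hasTemperateGrowth
    rw [e, SchwartzMap.fourier_lineDerivOp_eq, smul_apply,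
      SchwartzMap.smulLeftCLM_apply_apply ht, norm_smul, norm_smul]
    simp [mul_pow, abs_of_pos pi_pos]
    ring
  have hsq := fun i => integral_sq_integral_mul_inv_norm_sub_sq (∂_{b i} f)
  have hnewton := fun i => integral_mul_inv_norm_sub_eq_fourier (∂_{b i} f)
  simp_rw [hgrad]
  rw [integral_finsetSum _ fun i _ => (hsq i).1]
  simp_rw [fun i => (hsq i).2, fun i => (hnewton i).2]
  rw [← Finset.mul_sum, ← integral_finsetSum _ fun i _ => (hnewton i).1]
  have hk : ∀ᵐ k : E3, ∑ i, ‖𝓕 (complexify (∂_{b i} f)) k‖ ^ 2 * (1 / (π * ‖k‖ ^ 2)) =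
      4 * π * ‖𝓕 (complexify f) k‖ ^ 2 := by
    filter_upwards [Measure.ae_ne volume 0] with k hk
    have hk' : ‖k‖ ≠ 0 := norm_ne_zero_iff.2 hk
    have hs : ∑ i, ⟪k, b i⟫ ^ 2 = ‖k‖ ^ 2 := by
      rw [← b.sum_sq_norm_inner_left k]
      exact Finset.sum_congr rfl fun i _ => by rw [norm_eq_abs, sq_abs, real_inner_comm]
    simp_rw [hfour]
    rw [← Finset.sum_mul, ← Finset.sum_mul, ← Finset.mul_sum, hs]
    field_simp
  rw [integral_congr_ae hk, integral_const_mul, SchwartzMap.integral_norm_sq_fourier]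
  simp only [complexify_apply, Complex.norm_real, norm_eq_abs, sq_abs]
  ring

/-- The density `|ψ|²` of a Schwartz function `ψ`. -/
def density (ψ : 𝓢(E3, ℂ)) : 𝓢(E3, ℝ) := SchwartzMap.pairing (innerSL ℝ) ψ ψ

lemma density_apply (ψ : 𝓢(E3, ℂ)) (x : E3) : density ψ x = ‖ψ x‖ ^ 2 := by
  rw [density, SchwartzMap.pairing_apply_apply, innerSL_apply_apply, real_inner_self_eq_norm_sq]

lemma norm_gradient_pekarField_sq (ψ : 𝓢(E3, ℂ)) (x : E3) :
    ‖gradient (pekarField ψ) x‖ ^ 2 = (π ^ 3)⁻¹ *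
      ‖gradient (fun x : E3 => ∫ y, density ψ y * (1 / ‖x - y‖ ^ 2)) x‖ ^ 2 := by
  have e : pekarField ψ = fun x => π ^ (-(3 : ℝ) / 2) *
      ∫ y : E3, density ψ y * (1 / ‖x - y‖ ^ 2) := by
    funext x
    simp only [pekarField, density_apply, mul_one_div]
  have hπ : (π ^ (-(3 : ℝ) / 2)) ^ 2 = (π ^ 3)⁻¹ := by
    rw [← rpow_two, ← rpow_mul pi_pos.le, show -(3 : ℝ) / 2 * 2 = -(3 : ℕ) by norm_num,
      rpow_neg pi_pos.le, rpow_natCast]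
  rw [e, gradient, gradient, fderiv_const_mul
    (hasFDerivAt_integral_inv_norm_sq (density ψ) x).differentiableAt, map_smul, norm_smul, mul_pow,
    norm_eq_abs, sq_abs, hπ]

/-- The identity `(2/3) ∫ |∇φ_ψ|² = (8π/3) ∫ |ψ|⁴`, giving the two equivalent
expressions for the conjectured strong-coupling limit of the effective
polaron mass. -/
theorem pekarField_gradient_identity (ψ : SchwartzMap E3 ℂ) :
    (2 / 3) * (∫ x : E3, ‖gradient (pekarField ψ) x‖ ^ 2)
      = (8 * π / 3) * ∫ x : E3, ‖ψ x‖ ^ 4 := by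
  have h : ∀ x : E3, density ψ x ^ 2 = ‖ψ x‖ ^ 4 := fun x => by rw [density_apply]; ring
  simp_rw [norm_gradient_pekarField_sq]
  rw [integral_const_mul, integral_norm_gradient_sq]
  simp_rw [h]
  field_simp
  ring

end
end
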